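/- Let n ≥ 2 and define the logarithmic energy of n pairwise distinct points x_1,…,x_n ∈ [-1,1] as E_log(x_1,…,x_n) = -Σ_{i≠j} log|x_i - x_j| (sum over ordered pairs i ≠ j). Then the infimum ε_n of E_log over all n-tuples of pairwise distinct points in [-1,1] equals ε_n = -n(n-1)·log 2 - 3(n-1)·log(n-1) - n·log n - 4·Σ_{j=1}^{n-2} j·log j + Σ_{j=1}^{2n-2} j·log j. -/

import Mathlib

open Real MeasureTheory Finset

/-- The logarithmic energy of `n` points `x 0, …, x (n-1)`:
`E_log(x) = -∑_{i ≠ j} log |x i - x j|` (sum over ordered pairs). -/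
noncomputable def Elog (n : ℕ) (x : Fin n → ℝ) : ℝ :=
  -∑ i : Fin n, ∑ j : Fin n, if i ≠ j then Real.log |x i - x j| else 0

/-- The minimal logarithmic energy of `n` pairwise distinct points in `[-1,1]`. -/
noncomputable def minEnergy (n : ℕ) : ℝ :=
  sInf {E : ℝ | ∃ x : Fin n → ℝ, (∀ i, x i ∈ Set.Icc (-1 : ℝ) 1) ∧
    Function.Injective x ∧ E = Elog n x}

open Polynomial in
/-- Recurrence coefficient of the monic Legendre polynomials. -/
noncomputable def legB (m : ℕ) : ℝ := (m : ℝ) ^ 2 / ((2 * m - 1) * (2 * m + 1))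

open Polynomial in
/-- Monic Legendre polynomials. -/
noncomputable def legP : ℕ → ℝ[X]
  | 0 => 1
  | 1 => X
  | (k + 2) => C (-legB (k + 1)) * legP k + legP (k + 1) * X

open Polynomial in
/-- The monic polynomial of degree `k+2` vanishing at the Fekete points. -/
noncomputable def legW (k : ℕ) : ℝ[X] :=
  C (-((k + 1 : ℝ) / (2 * k + 1))) * legP k + legP (k + 1) * X

open Polynomial in
lemma monic_step {p q : ℝ[X]} (c : ℝ) {m : ℕ} (hp : p.Monic) (hpd : p.natDegree = m + 1)
    (hqd : q.natDegree ≤ m) : (C c * q + p * X).Monic ∧ (C c * q + p * X).natDegree = m + 2 := by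
  have h1 : (p * X).Monic := hp.mul monic_X
  have h2 : (p * X).natDegree = m + 2 := by
    rw [hp.natDegree_mul monic_X, hpd, natDegree_X]
  have h3 : (C c * q).natDegree ≤ m := (natDegree_C_mul_le _ _).trans hqd
  have h4 : (C c * q).degree < (p * X).degree := by
    apply degree_lt_degree; omega
  refine ⟨h1.add_of_right h4, ?_⟩
  rw [natDegree_add_eq_right_of_degree_lt h4, h2]

open Polynomial in
lemma legP_monic (k : ℕ) : ((legP k).Monic ∧ (legP k).natDegree = k) ∧
    ((legP (k + 1)).Monic ∧ (legP (k + 1)).natDegree = k + 1) := by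
  induction k with
  | zero => simp [legP, monic_X]
  | succ k ih =>
    refine ⟨ih.2, ?_⟩
    rw [legP]
    exact monic_step _ ih.2.1 ih.2.2 ih.1.2.le

open Polynomial in
lemma legW_monic (k : ℕ) : (legW k).Monic ∧ (legW k).natDegree = k + 2 := by
  have ih := legP_monic k
  exact monic_step _ ih.2.1 ih.2.2 ih.1.2.le

open Polynomial in
lemma res_step {p q : ℝ[X]} (c : ℝ) {m : ℕ} (hp : p.Monic) (hpd : p.natDegree = m + 1)
    (hqd : q.natDegree ≤ m) :
    |resultant (C (-c) * q + p * X) p (m + 2) (m + 1)| =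
      |c| ^ (m + 1) * |resultant p q (m + 1) m| := by
  rw [resultant_add_mul_left _ _ _ _ _ (by rw [natDegree_X]; omega) hpd.le,
    resultant_C_mul_left, resultant_add_left_deg _ _ _ _ _ hqd, resultant_comm]
  have : p.coeff (m + 1) = 1 := by rw [← hpd]; exact hp
  rw [this]
  simp [abs_mul, abs_pow]

/-- Absolute value of the resultant of consecutive Legendre polynomials. -/
noncomputable def legR : ℕ → ℝ
  | 0 => 1
  | (k + 1) => legB (k + 1) ^ (k + 1) * legR k

lemma legB_pos (k : ℕ) : 0 < legB (k + 1) := by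
  unfold legB
  have : (0:ℝ) ≤ k := k.cast_nonneg
  push_cast
  apply div_pos (by positivity)
  apply mul_pos <;> linarith

open Polynomial in
lemma legR_eq (k : ℕ) : |resultant (legP (k + 1)) (legP k) (k + 1) k| = legR k := by
  induction k with
  | zero => simp [legP, legR]
  | succ k ih =>
    have h := legP_monic k
    rw [legP, res_step _ h.2.1 h.2.2 h.1.2.le, ih, legR, abs_of_pos (legB_pos k)]

open Polynomial in
lemma legW_res (k : ℕ) : |resultant (legW k) (legP (k + 1)) (k + 2) (k + 1)| =
    ((k + 1 : ℝ) / (2 * k + 1)) ^ (k + 1) * legR k := by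
  have h := legP_monic k
  rw [legW, res_step _ h.2.1 h.2.2 h.1.2.le, legR_eq, abs_of_nonneg (by positivity)]

open Polynomial in
lemma leg_rel (k : ℕ) :
    ((X ^ 2 - 1) * derivative (legP (k + 1)) = C (k + 1 : ℝ) * legW k) ∧
    (derivative (legP (k + 1)) * X - C ((k + 1 : ℝ) / (2 * k + 1)) * derivative (legP k)
      = C (k + 1 : ℝ) * legP (k + 1)) := by
  induction k with
  | zero => simp [legP, legW]; ring
  | succ k ih =>
    obtain ⟨hA, hB⟩ := ih
    have e1 : legB (k + 1) = ((k + 1 : ℝ) / (2 * k + 1)) * ((k + 1 : ℝ) / (2 * k + 3)) := by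
      unfold legB; push_cast
      have h1 : (2 * (k + 1 : ℝ) - 1) = 2 * k + 1 := by ring
      have h2 : (2 * (k + 1 : ℝ) + 1) = 2 * k + 3 := by ring
      rw [h1, h2, div_mul_div_comm, sq]
    have e2 : ((k + 1 + 1 : ℝ) / (2 * (k + 1) + 1)) = 1 - ((k + 1 : ℝ) / (2 * k + 3)) := by
      field_simp; ring
    have e4 : C (k + 1 : ℝ) = C ((k + 1 : ℝ) / (2 * k + 3)) * (C 2 * C (k + 1 : ℝ) + 1) := by
      rw [← C_mul, ← C_1, ← C_add, ← C_mul]; congr 1; field_simp; ring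
    have e3 : C ((k:ℝ) + 1 + 1) = C (k + 1 : ℝ) + 1 := by rw [C_add, C_1]
    have e5 : (C (2:ℝ)) = 2 := map_ofNat C 2
    rw [e5] at e4
    simp only [legW, legP] at *
    push_cast
    rw [e1, e2, e3]
    simp only [derivative_add, derivative_mul, C_neg, C_mul, derivative_neg, derivative_C, derivative_X, C_sub,
      C_1, derivative_neg, mul_zero, zero_mul, neg_zero, zero_add, add_zero] at *
    generalize derivative (legP (k + 1)) = d1 at *
    generalize derivative (legP k) = d0 at *
    generalize legP (k + 1) = p1 at *
    generalize legP k = p0 at *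
    generalize C ((k + 1 : ℝ) / (2 * k + 3)) = s at *
    generalize C ((k + 1 : ℝ) / (2 * k + 1)) = b at *
    generalize C (k + 1 : ℝ) = N at *
    constructor
    · linear_combination s * (X ^ 2 - 1) * hB + (1 - s) * X * hA + (p1 - b * p0 * X) * e4
    · linear_combination s * X * hB + (1 - s) * hA - b * p0 * e4

open Polynomial in
lemma legW_deriv (k : ℕ) : derivative (legW k) = C (k + 2 : ℝ) * legP (k + 1) := by
  have h := (leg_rel k).2
  have e : C (k + 2 : ℝ) = C (k + 1 : ℝ) + 1 := by rw [← C_1, ← C_add]; congr 1; ring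
  rw [legW, e]
  simp only [derivative_add, derivative_mul, derivative_C, derivative_X, C_neg]
  simp only [derivative_neg, derivative_C]
  linear_combination h

open Polynomial in
lemma legW_ode (k : ℕ) : (X ^ 2 - 1) * derivative (derivative (legW k)) =
    C ((k + 2 : ℝ) * (k + 1)) * legW k := by
  rw [legW_deriv, derivative_C_mul, C_mul]
  linear_combination C (k + 2 : ℝ) * (leg_rel k).1

open Polynomial in
/-- Leading coefficient of the differential operator applied to a polynomial. -/
lemma ode_coeff (w : ℝ[X]) (m : ℕ) (h : w.natDegree ≤ m) :
    ((X ^ 2 - 1) * derivative (derivative w)).coeff m = (m : ℝ) * (m - 1) * w.coeff m := by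
  have h0 : (derivative (derivative w)).coeff m = 0 := by
    simp [coeff_derivative, coeff_eq_zero_of_natDegree_lt (show w.natDegree < m + 1 + 1 by omega)]
  rw [sub_mul, one_mul, coeff_sub, h0, mul_comm, sub_zero]
  rcases m with _ | _ | m
  · simp
  · simp [pow_two, ← mul_assoc]
  · rw [coeff_mul_X_pow]
    simp [coeff_derivative]
    ring

open Polynomial in
lemma ode_unique (k : ℕ) (v w : ℝ[X]) (hv : v.Monic) (hw : w.Monic) (hvd : v.natDegree = k + 2)
    (hwd : w.natDegree = k + 2)
    (hv2 : (X ^ 2 - 1) * derivative (derivative v) = C ((k + 2 : ℝ) * (k + 1)) * v)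
    (hw2 : (X ^ 2 - 1) * derivative (derivative w) = C ((k + 2 : ℝ) * (k + 1)) * w) : v = w := by
  by_contra hne
  have hd0 : v - w ≠ 0 := sub_ne_zero.mpr hne
  have hdeg : (v - w).degree < v.degree := by
    apply degree_sub_lt_left
    · rw [degree_eq_natDegree hv.ne_zero, degree_eq_natDegree hw.ne_zero, hvd, hwd]
    · exact hv.ne_zero
    · rw [hv.leadingCoeff, hw.leadingCoeff]
  have hlt : (v - w).natDegree < k + 2 := hvd ▸ natDegree_lt_natDegree hd0 hdeg
  have hode : (X ^ 2 - 1) * derivative (derivative (v - w)) =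
      C ((k + 2 : ℝ) * (k + 1)) * (v - w) := by
    simp only [derivative_sub]; linear_combination hv2 - hw2
  have hc := congrArg (fun p => p.coeff (v - w).natDegree) hode
  rw [ode_coeff _ _ le_rfl, coeff_C_mul] at hc
  have hl : (v - w).coeff (v - w).natDegree ≠ 0 := by simpa using hd0
  have hc2 := mul_right_cancel₀ hl hc
  have hle : ((v - w).natDegree : ℝ) ≤ k + 1 := by exact_mod_cast (by omega : _ ≤ k + 1)
  have h0 : (0 : ℝ) ≤ (v - w).natDegree := Nat.cast_nonneg _
  have hk : (0 : ℝ) ≤ k := Nat.cast_nonneg _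
  nlinarith

open Polynomial in
lemma prod_eval_eq (k : ℕ) (x : Fin (k + 2) → ℝ) (hx : ∏ i, (X - C (x i)) = legW k) :
    ∏ i, |(legP (k + 1)).eval (x i)| = ((k + 1 : ℝ) / (2 * k + 1)) ^ (k + 1) * legR k := by
  rw [← legW_res, ← hx, ← Finset.abs_prod]
  have hd : (∏ i, (X - C (x i))).natDegree = k + 2 := by rw [hx]; exact (legW_monic k).2
  have h := resultant_prod_left Finset.univ (fun i => X - C (x i)) (legP (k + 1)) (k + 1)
    (by simp) (legP_monic k).2.2.le
  rw [hd] at h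
  rw [h]
  congr 1
  refine Finset.prod_congr rfl fun i _ => ?_
  have := resultant_X_sub_C_pow_left (x i) (legP (k + 1)) 1 (k + 1) (legP_monic k).2.2.le
  rw [pow_one, pow_one] at this
  rw [natDegree_X_sub_C, this]

lemma final_algebra (k : ℕ) :
    -Real.log ((k + 2 : ℝ) ^ (k + 2) * (((k + 1 : ℝ) / (2 * k + 1)) ^ (k + 1) * legR k)) =
      -((k + 2) * (k + 1) : ℝ) * Real.log 2 - 3 * (k + 1 : ℝ) * Real.log (k + 1 : ℝ)
        - (k + 2) * Real.log (k + 2)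
        - 4 * ∑ j ∈ Finset.Icc 1 k, (j : ℝ) * Real.log j
        + ∑ j ∈ Finset.Icc 1 (2 * k + 2), (j : ℝ) * Real.log j := by
  have hR : ∀ k, 0 < legR k := by
    intro k
    induction k with
    | zero => simp [legR]
    | succ k ih => rw [legR]; exact mul_pos (pow_pos (legB_pos k) _) ih
  have key : ∀ k : ℕ, ((k + 1 : ℝ) * (Real.log (k + 1) - Real.log (2 * k + 1))) +
      Real.log (legR k) = (k + 2) * (k + 1) * Real.log 2 + 3 * (k + 1 : ℝ) * Real.log (k + 1 : ℝ)
      + 4 * ∑ j ∈ Finset.Icc 1 k, (j : ℝ) * Real.log j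
        - ∑ j ∈ Finset.Icc 1 (2 * k + 2), (j : ℝ) * Real.log j := by
    intro k
    induction k with
    | zero => 
      have : Finset.Icc 1 2 = {1, 2} := by decide
      simp [legR, this]
    | succ k ih =>
      have e : 2 * (k + 1) + 2 = 2 * k + 2 + 1 + 1 := by ring
      rw [e, Finset.sum_Icc_succ_top (by omega), Finset.sum_Icc_succ_top (by omega),
        Finset.sum_Icc_succ_top (by omega), legR, Real.log_mul (pow_pos (legB_pos k) _).ne'
        (hR k).ne', Real.log_pow]
      have hB : Real.log (legB (k + 1)) =
          2 * Real.log (k + 1) - (Real.log (2 * k + 1) + Real.log (2 * k + 3)) := by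
        have h1 : legB (k + 1) = (k + 1 : ℝ) ^ 2 / ((2 * k + 1) * (2 * k + 3)) := by
          unfold legB; push_cast; congr 1; ring
        rw [h1, Real.log_div (by positivity) (by positivity), Real.log_pow,
          Real.log_mul (by positivity) (by positivity)]
        norm_num
      rw [hB]
      have h4 : Real.log (((2 * k + 2 + 1 + 1 : ℕ) : ℝ)) = Real.log 2 + Real.log (k + 1 + 1) := by
        rw [← Real.log_mul (by positivity) (by positivity)]; congr 1; push_cast; ring
      have h3 : Real.log (((2 * k + 2 + 1 : ℕ) : ℝ)) = Real.log (2 * k + 3) := by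
        congr 1; push_cast; ring
      have h5 : Real.log (2 * (k + 1 : ℝ) + 1) = Real.log (2 * k + 3) := by
        congr 1; ring
      rw [h4, h3]
      push_cast
      rw [h5]
      linear_combination ih
  have := key k
  have hk := hR k
  rw [Real.log_mul (by positivity) (by positivity), Real.log_mul (by positivity) (by positivity),
    Real.log_pow, Real.log_pow, Real.log_div (by positivity) (by positivity)]
  push_cast
  linear_combination -this

/-- The product of the mutual distances over ordered pairs. -/
noncomputable def pairProd {n : ℕ} (x : Fin n → ℝ) : ℝ :=
  ∏ i, ∏ j ∈ Finset.univ.erase i, |x i - x j|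

lemma pairProd_pos {n : ℕ} {x : Fin n → ℝ} (hx : Function.Injective x) : 0 < pairProd x := by
  refine Finset.prod_pos fun i _ => Finset.prod_pos fun j hj => ?_
  rw [abs_pos, sub_ne_zero]
  exact fun h => (Finset.mem_erase.1 hj).1 (hx h).symm

lemma Elog_eq {n : ℕ} {x : Fin n → ℝ} (hx : Function.Injective x) :
    Elog n x = -Real.log (pairProd x) := by
  have h : ∀ i, ∀ j ∈ Finset.univ.erase i, |x i - x j| ≠ 0 := by
    intro i j hj
    rw [abs_ne_zero, sub_ne_zero]
    exact fun h => (Finset.mem_erase.1 hj).1 (hx h).symm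
  unfold Elog pairProd
  rw [Real.log_prod (fun i _ => Finset.prod_ne_zero_iff.2 (h i))]
  congr 1
  refine Finset.sum_congr rfl fun i _ => ?_
  rw [Real.log_prod (h i), ← Finset.sum_filter]
  refine Finset.sum_congr ?_ fun _ _ => rfl
  ext j; simp [eq_comm]

lemma injective_of_pairProd_pos {n : ℕ} {x : Fin n → ℝ} (h : 0 < pairProd x) :
    Function.Injective x := by
  intro i j hij
  by_contra hne
  have : pairProd x = 0 := by
    refine Finset.prod_eq_zero (Finset.mem_univ i) (Finset.prod_eq_zero (i := j) ?_ ?_)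
    · simp [Ne.symm hne]
    · simp [hij]
  linarith

lemma pairProd_split {n : ℕ} (x : Fin n → ℝ) (k : Fin n) :
    pairProd x = (∏ j ∈ Finset.univ.erase k, |x k - x j|) ^ 2 *
      ∏ i ∈ Finset.univ.erase k, ∏ j ∈ (Finset.univ.erase i).erase k, |x i - x j| := by
  unfold pairProd
  rw [← Finset.mul_prod_erase _ _ (Finset.mem_univ k), sq, mul_assoc]
  congr 1
  rw [← Finset.prod_mul_distrib]
  refine Finset.prod_congr rfl fun i hi => ?_
  have : k ∈ Finset.univ.erase i := by
    simp only [Finset.mem_erase, Finset.mem_univ, and_true, ne_eq] at hi ⊢; exact fun h => hi h.symm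
  rw [← Finset.mul_prod_erase _ _ this, abs_sub_comm]

lemma exists_max (n : ℕ) : ∃ x : Fin n → ℝ, (∀ i, x i ∈ Set.Icc (-1 : ℝ) 1) ∧
    Function.Injective x ∧
    ∀ y : Fin n → ℝ, (∀ i, y i ∈ Set.Icc (-1 : ℝ) 1) → pairProd y ≤ pairProd x := by
  have hc : IsCompact (Set.univ.pi fun _ : Fin n => Set.Icc (-1 : ℝ) 1) :=
    isCompact_univ_pi fun _ => isCompact_Icc
  have hcont : Continuous (pairProd (n := n)) := by unfold pairProd; fun_prop
  let z : Fin n → ℝ := fun i => (i : ℝ) / n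
  have hz : ∀ i, z i ∈ Set.Icc (-1 : ℝ) 1 := by
    intro i
    have h0 : (0 : ℝ) < n := by exact_mod_cast i.pos
    have h1 : ((i : ℕ) : ℝ) ≤ n := by exact_mod_cast i.2.le
    exact ⟨by have : 0 ≤ z i := by positivity
              linarith, (div_le_one h0).2 h1⟩
  have hzi : Function.Injective z := by
    intro i j h
    have h0 : (n : ℝ) ≠ 0 := by exact_mod_cast i.pos.ne'
    have h2 : ((i : ℕ) : ℝ) = (j : ℕ) := (div_left_inj' h0).1 h
    exact Fin.ext (by exact_mod_cast h2)
  obtain ⟨x, hx, hmax⟩ := hc.exists_isMaxOn ⟨z, fun i _ => hz i⟩ hcont.continuousOn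
  refine ⟨x, fun i => hx i trivial, ?_, fun y hy => hmax (fun i _ => hy i)⟩
  exact injective_of_pairProd_pos ((pairProd_pos hzi).trans_le (hmax (fun i _ => hz i)))

lemma fek_max_one {n : ℕ} {x : Fin n → ℝ} (hI : ∀ i, x i ∈ Set.Icc (-1 : ℝ) 1)
    (hx : Function.Injective x)
    (hmax : ∀ y : Fin n → ℝ, (∀ i, y i ∈ Set.Icc (-1 : ℝ) 1) → pairProd y ≤ pairProd x)
    (k : Fin n) (t : ℝ) (ht : t ∈ Set.Icc (-1 : ℝ) 1) :
    ∏ j ∈ Finset.univ.erase k, |t - x j| ≤ ∏ j ∈ Finset.univ.erase k, |x k - x j| := by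
  have h := hmax (Function.update x k t) (by
    intro i
    by_cases h : i = k
    · subst h; simpa using ht
    · simpa [h] using hI i)
  have hpos : 0 < pairProd x := pairProd_pos hx
  rw [pairProd_split x k] at h hpos
  rw [pairProd_split _ k] at h
  have e1 : ∏ j ∈ Finset.univ.erase k, |Function.update x k t k - Function.update x k t j| =
      ∏ j ∈ Finset.univ.erase k, |t - x j| := by
    refine Finset.prod_congr rfl fun j hj => ?_
    simp [(Finset.mem_erase.1 hj).1]
  have e2 : ∏ i ∈ Finset.univ.erase k, ∏ j ∈ (Finset.univ.erase i).erase k,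
      |Function.update x k t i - Function.update x k t j| =
      ∏ i ∈ Finset.univ.erase k, ∏ j ∈ (Finset.univ.erase i).erase k, |x i - x j| := by
    refine Finset.prod_congr rfl fun i hi => Finset.prod_congr rfl fun j hj => ?_
    simp [(Finset.mem_erase.1 hj).1, (Finset.mem_erase.1 hi).1]
  rw [e1, e2] at h
  have hG : 0 < ∏ i ∈ Finset.univ.erase k, ∏ j ∈ (Finset.univ.erase i).erase k, |x i - x j| :=
    pos_of_mul_pos_right hpos (sq_nonneg _)
  have h2 := le_of_mul_le_mul_right h hG
  exact (sq_le_sq₀ (Finset.prod_nonneg fun _ _ => abs_nonneg _)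
    (Finset.prod_nonneg fun _ _ => abs_nonneg _)).1 h2

open Polynomial in
lemma fek_deriv_zero {n : ℕ} {x : Fin n → ℝ} (hx : Function.Injective x) (k : Fin n)
    (hk : x k ∈ Set.Ioo (-1 : ℝ) 1)
    (hm : ∀ t ∈ Set.Icc (-1 : ℝ) 1,
      ∏ j ∈ Finset.univ.erase k, |t - x j| ≤ ∏ j ∈ Finset.univ.erase k, |x k - x j|) :
    (derivative (∏ j ∈ Finset.univ.erase k, (X - C (x j)))).eval (x k) = 0 := by
  set g : ℝ[X] := ∏ j ∈ Finset.univ.erase k, (X - C (x j)) with hg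
  have hev : ∀ t, |g.eval t| = ∏ j ∈ Finset.univ.erase k, |t - x j| := by
    intro t; rw [hg, eval_prod, Finset.abs_prod]; simp
  have hne : g.eval (x k) ≠ 0 := by
    rw [hg, eval_prod, Finset.prod_ne_zero_iff]
    intro j hj
    simp only [eval_sub, eval_X, eval_C, sub_ne_zero]
    exact fun h => (Finset.mem_erase.1 hj).1 (hx h).symm
  have hloc : IsLocalMax (fun t => (g ^ 2).eval t) (x k) := by
    filter_upwards [Ioo_mem_nhds hk.1 hk.2] with t ht
    rw [eval_pow, eval_pow]
    apply sq_le_sq.2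
    rw [hev, hev]
    exact hm t ⟨ht.1.le, ht.2.le⟩
  have h0 := hloc.hasDerivAt_eq_zero ((g ^ 2).hasDerivAt (x k))
  rw [derivative_pow] at h0
  simp at h0
  tauto

open Polynomial in
lemma fekete_ode {k : ℕ} {x : Fin (k + 2) → ℝ} (hI : ∀ i, x i ∈ Set.Icc (-1 : ℝ) 1)
    (hx : Function.Injective x)
    (hm : ∀ k, ∀ t ∈ Set.Icc (-1 : ℝ) 1,
      ∏ j ∈ Finset.univ.erase k, |t - x j| ≤ ∏ j ∈ Finset.univ.erase k, |x k - x j|) :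
    ∏ i, (X - C (x i)) = legW k := by
  have hmon : (∏ i, (X - C (x i))).Monic := monic_prod_of_monic _ _ fun i _ => monic_X_sub_C _
  have hdeg : (∏ i, (X - C (x i))).natDegree = k + 2 := by
    rw [natDegree_prod_of_monic _ _ fun i _ => monic_X_sub_C _]; simp
  refine ode_unique k _ _ hmon (legW_monic k).1 hdeg (legW_monic k).2 ?_ (legW_ode k)
  have hsplit : ∀ i, ∏ i, (X - C (x i)) =
      (X - C (x i)) * ∏ j ∈ Finset.univ.erase i, (X - C (x j)) :=
    fun i => (Finset.mul_prod_erase _ _ (Finset.mem_univ i)).symm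
  set w := ∏ i, (X - C (x i)) with hw
  rw [← sub_eq_zero]
  refine eq_zero_of_degree_lt_of_eval_index_eq_zero (s := Finset.univ) (v := x) hx.injOn ?_ ?_
  · rw [degree_lt_iff_coeff_zero]
    intro m hm'
    simp only [Finset.card_univ, Fintype.card_fin] at hm'
    rw [coeff_sub, ode_coeff w m (by omega), coeff_C_mul]
    rcases Nat.eq_or_lt_of_le hm' with rfl | h
    · push_cast; ring
    · rw [coeff_eq_zero_of_natDegree_lt (by omega)]; simp
  · intro i _
    have hwi : w.eval (x i) = 0 := by rw [hsplit i]; simp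
    simp only [eval_sub, eval_mul, eval_C, hwi, mul_zero, sub_zero, eval_pow, eval_X, eval_one]
    by_cases h1 : x i = 1
    · rw [h1]; norm_num
    by_cases h2 : x i = -1
    · rw [h2]; norm_num
    have hd := fek_deriv_zero hx i ⟨lt_of_le_of_ne (hI i).1 (Ne.symm h2), lt_of_le_of_ne (hI i).2 h1⟩
      (hm i)
    rw [hsplit i]
    simp [derivative_mul, hd]

lemma max_value {k : ℕ} {x : Fin (k + 2) → ℝ} (hI : ∀ i, x i ∈ Set.Icc (-1 : ℝ) 1)
    (hx : Function.Injective x)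
    (hmax : ∀ y : Fin (k + 2) → ℝ, (∀ i, y i ∈ Set.Icc (-1 : ℝ) 1) → pairProd y ≤ pairProd x) :
    pairProd x = (k + 2 : ℝ) ^ (k + 2) * (((k + 1 : ℝ) / (2 * k + 1)) ^ (k + 1) * legR k) := by
  have hw := fekete_ode hI hx (fek_max_one hI hx hmax)
  rw [← prod_eval_eq k x hw]
  have h : ∀ i, ∏ j ∈ Finset.univ.erase i, |x i - x j| =
      (k + 2 : ℝ) * |(legP (k + 1)).eval (x i)| := by
    intro i
    have h1 := congrArg (fun p => |(Polynomial.derivative p).eval (x i)|) hw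
    rw [legW_deriv, ← Finset.mul_prod_erase _ _ (Finset.mem_univ i)] at h1
    simp only [Polynomial.derivative_mul, Polynomial.eval_add, Polynomial.eval_mul,
      Polynomial.eval_sub, Polynomial.eval_X, Polynomial.eval_C, sub_self, zero_mul, add_zero,
      Polynomial.derivative_X_sub_C, Polynomial.eval_one, one_mul, Polynomial.eval_prod,
      Finset.abs_prod, abs_mul] at h1
    rw [h1, abs_of_nonneg (by positivity)]
  unfold pairProd
  rw [Finset.prod_congr rfl fun i _ => h i, Finset.prod_mul_distrib]
  simp

theorem min_log_energy_interval (n : ℕ) (hn : 2 ≤ n) :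
    minEnergy n =
      -(n * (n - 1) : ℝ) * Real.log 2 - 3 * ((n : ℝ) - 1) * Real.log ((n : ℝ) - 1)
        - n * Real.log n
        - 4 * ∑ j ∈ Finset.Icc 1 (n - 2), (j : ℝ) * Real.log j
        + ∑ j ∈ Finset.Icc 1 (2 * n - 2), (j : ℝ) * Real.log j := by
  obtain ⟨k, rfl⟩ := Nat.exists_eq_add_of_le' hn
  obtain ⟨x, hI, hx, hmax⟩ := exists_max (k + 2)
  have hleast : IsLeast {E : ℝ | ∃ x : Fin (k + 2) → ℝ, (∀ i, x i ∈ Set.Icc (-1 : ℝ) 1) ∧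
      Function.Injective x ∧ E = Elog (k + 2) x} (-Real.log (pairProd x)) := by
    refine ⟨⟨x, hI, hx, (Elog_eq hx).symm⟩, ?_⟩
    rintro E ⟨y, hyI, hy, rfl⟩
    rw [Elog_eq hy]
    exact neg_le_neg (Real.log_le_log (pairProd_pos hy) (hmax y hyI))
  rw [minEnergy, hleast.csInf_eq, max_value hI hx hmax, final_algebra]
  have e1 : k + 2 - 2 = k := by omega
  have e2 : 2 * (k + 2) - 2 = 2 * k + 2 := by omega
  have e3 : ((k + 2 : ℕ) : ℝ) - 1 = k + 1 := by push_cast; ring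
  rw [e1, e2, e3]
  push_cast
  ring
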